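/- arXiv:1607.05285 — 3 statements merged into one kernel-verified Lean document; each statement's English description precedes it below -/
import Mathlib

section
/- Let V be a real symmetric positive definite quantum covariance matrix on three subsystems A, B, C, i.e., V + i·Ω is positive semidefinite as a complex matrix, where Ω = Ω_{n_A} ⊕ Ω_{n_B} ⊕ Ω_{n_C}. Then V_{AC}/V_A ≥ Ω_{n_C}ᵀ (V_{BC}/V_B)⁻¹ Ω_{n_C} in the Loewner order (monogamy of the Schur complement of quantum covariance matrices). -/
open Matrix
open scoped ComplexOrder Kronecker

noncomputable section

/-- The standard symplectic form on a single mode. -/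
def J2 : Matrix (Fin 2) (Fin 2) ℝ := !![0, 1; -1, 0]

/-- The standard symplectic form on `n` modes: the direct sum of `n` copies of
`[[0,1],[-1,0]]`, realized on the index type `Fin n × Fin 2`. -/
def Omega (n : ℕ) : Matrix (Fin n × Fin 2) (Fin n × Fin 2) ℝ :=
  (1 : Matrix (Fin n) (Fin n) ℝ) ⊗ₖ J2

/-- `V` is a quantum covariance matrix with respect to the symplectic form `Om`:
the complex matrix `V + i·Om` is positive semidefinite. -/
def QCM {ι : Type*} [Fintype ι] (Om V : Matrix ι ι ℝ) : Prop :=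
  (V.map Complex.ofReal + Complex.I • Om.map Complex.ofReal).PosSemidef

/-- The positive semidefinite square root of a positive semidefinite real matrix
(junk value `0` if the matrix is not positive semidefinite). -/
def msqrt {ι : Type*} [Fintype ι] [DecidableEq ι] (A : Matrix ι ι ℝ) : Matrix ι ι ℝ := by
  classical exact if h : A.PosSemidef then
    (h.1.eigenvectorUnitary : Matrix ι ι ℝ) *
      diagonal ((RCLike.ofReal : ℝ → ℝ) ∘ Real.sqrt ∘ h.1.eigenvalues) *
      (star h.1.eigenvectorUnitary : Matrix ι ι ℝ) else 0

/-- `g₋(A) = Σ_i max(−log ν_i, 0)` where `ν_1, …, ν_n` are the symplectic eigenvalues of `A`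
(w.r.t. the symplectic form `Om`), i.e. the eigenvalues of the Hermitian matrix
`i·√A·Om·√A` are exactly `±ν_1, …, ±ν_n`; equivalently, half the sum of
`max(−log |λ|, 0)` over all eigenvalues `λ` of `i·√A·Om·√A`. -/
def gMinus {ι : Type*} [Fintype ι] [DecidableEq ι] (Om A : Matrix ι ι ℝ) : ℝ := by
  classical exact
    if h : (Complex.I • ((msqrt A * Om * msqrt A).map Complex.ofReal)).IsHermitian then
      (∑ j, max (-Real.log |h.eigenvalues j|) 0) / 2
    else 0

/-- `g₊(A) = Σ_i max(log ν_i, 0)` where `ν_1, …, ν_n` are the symplectic eigenvalues of `A`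
(w.r.t. the symplectic form `Om`). -/
def gPlus {ι : Type*} [Fintype ι] [DecidableEq ι] (Om A : Matrix ι ι ℝ) : ℝ := by
  classical exact
    if h : (Complex.I • ((msqrt A * Om * msqrt A).map Complex.ofReal)).IsHermitian then
      (∑ j, max (Real.log |h.eigenvalues j|) 0) / 2
    else 0

/-- Schur complement of the first (upper-left) diagonal block of a block matrix:
`M/M₁₁ = M₂₂ − M₂₁ M₁₁⁻¹ M₁₂`. -/
def schurA {a b : Type*} [Fintype a] [DecidableEq a]
    (M : Matrix (a ⊕ b) (a ⊕ b) ℝ) : Matrix b b ℝ :=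
  M.toBlocks₂₂ - M.toBlocks₂₁ * M.toBlocks₁₁⁻¹ * M.toBlocks₁₂

/-- Schur complement of the second (lower-right) diagonal block of a block matrix:
`M/M₂₂ = M₁₁ − M₁₂ M₂₂⁻¹ M₂₁`. -/
def schurB {a b : Type*} [Fintype b] [DecidableEq b]
    (M : Matrix (a ⊕ b) (a ⊕ b) ℝ) : Matrix a a ℝ :=
  M.toBlocks₁₁ - M.toBlocks₁₂ * M.toBlocks₂₂⁻¹ * M.toBlocks₂₁

/-- Embedding of the `A ⊕ C` indices into `A ⊕ (B ⊕ C)`. -/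
def embAC {a b c : Type*} : a ⊕ c → a ⊕ (b ⊕ c) :=
  Sum.elim Sum.inl (Sum.inr ∘ Sum.inr)

/-- Embedding of the `A ⊕ B` indices into `A ⊕ (B ⊕ C)`. -/
def embAB {a b c : Type*} : a ⊕ b → a ⊕ (b ⊕ c) :=
  Sum.elim Sum.inl (Sum.inr ∘ Sum.inl)


lemma Omega_transpose (n : ℕ) : (Omega n)ᵀ = - Omega n := by
  ext ⟨i, a⟩ ⟨j, b⟩
  fin_cases a <;> fin_cases b <;>
    simp [Omega, J2, Matrix.one_apply, eq_comm]

lemma qcm_real {ι : Type*} [Fintype ι] (Om V : Matrix ι ι ℝ) (hO : Omᵀ = -Om) (hV : V.IsSymm)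
    (h : QCM Om V) (x y : ι → ℝ) :
    0 ≤ x ⬝ᵥ V *ᵥ x + y ⬝ᵥ V *ᵥ y - 2 * (x ⬝ᵥ Om *ᵥ y) := by
  have h1 := (Complex.nonneg_iff.1
    (h.dotProduct_mulVec_nonneg (fun i => (x i : ℂ) + Complex.I * (y i : ℂ)))).1
  have e2 : y ⬝ᵥ Om *ᵥ x = - (x ⬝ᵥ Om *ᵥ y) := by
    rw [dotProduct_mulVec, ← mulVec_transpose, hO, neg_mulVec, neg_dotProduct, dotProduct_comm]
  have e3 : (star (fun i => (x i : ℂ) + Complex.I * (y i : ℂ)) ⬝ᵥ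
      (V.map Complex.ofReal + Complex.I • Om.map Complex.ofReal) *ᵥ
        (fun i => (x i : ℂ) + Complex.I * (y i : ℂ))).re
      = x ⬝ᵥ V *ᵥ x + y ⬝ᵥ V *ᵥ y - (x ⬝ᵥ Om *ᵥ y) + y ⬝ᵥ Om *ᵥ x := by
    simp only [dotProduct, mulVec, Finset.mul_sum, Complex.re_sum, ← Finset.sum_add_distrib,
      ← Finset.sum_sub_distrib]
    refine Finset.sum_congr rfl fun i _ => Finset.sum_congr rfl fun j _ => ?_
    simp
    ring
  rw [e3, e2] at h1
  linarith

lemma schurA_quad {a c : Type*} [Fintype a] [DecidableEq a] [Fintype c]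
    (M : Matrix (a ⊕ c) (a ⊕ c) ℝ) (hM : M.PosDef) (x : c → ℝ) :
    ∃ z : a → ℝ, Sum.elim z x ⬝ᵥ M *ᵥ Sum.elim z x = x ⬝ᵥ schurA M *ᵥ x := by
  have hA : M.toBlocks₁₁.PosDef := hM.submatrix Sum.inl_injective
  have : Invertible M.toBlocks₁₁ := hA.isUnit.invertible
  have h21 : M.toBlocks₂₁ = M.toBlocks₁₂ᴴ := by
    ext i j; exact (hM.1.apply _ _).symm
  refine ⟨-((M.toBlocks₁₁⁻¹ * M.toBlocks₁₂) *ᵥ x), ?_⟩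
  have := schur_complement_eq₁₁ M.toBlocks₁₂ M.toBlocks₂₂
    (-((M.toBlocks₁₁⁻¹ * M.toBlocks₁₂) *ᵥ x)) x hA.1
  rw [← h21, fromBlocks_toBlocks] at this
  simp only [neg_add_cancel, star_trivial, zero_vecMul, zero_dotProduct, zero_add,
    ← dotProduct_mulVec] at this
  exact this

lemma schurA_symm {a c : Type*} [Fintype a] [DecidableEq a]
    (M : Matrix (a ⊕ c) (a ⊕ c) ℝ) (hM : M.IsSymm) : (schurA M)ᵀ = schurA M := by
  have h21 : M.toBlocks₂₁ = M.toBlocks₁₂ᵀ := by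
    ext i j; exact (hM.apply _ _).symm
  have h11 : M.toBlocks₁₁ᵀ = M.toBlocks₁₁ := by
    ext i j; exact hM.apply _ _
  have h22 : M.toBlocks₂₂ᵀ = M.toBlocks₂₂ := by
    ext i j; exact hM.apply _ _
  simp [schurA, h21, h22, transpose_nonsing_inv, h11, Matrix.mul_assoc]

/-- **Theorem 3 (Schur complement of quantum CMs is monogamous).**
If `V > 0` is a real symmetric quantum covariance matrix on `A ⊕ (B ⊕ C)`
(i.e. `V + i·Ω ≥ 0`), then `V_{AC}/V_A ≥ Ω_Cᵀ (V_{BC}/V_B)⁻¹ Ω_C`. -/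
theorem schur_complement_monogamy (nA nB nC : ℕ)
    (V : Matrix ((Fin nA × Fin 2) ⊕ ((Fin nB × Fin 2) ⊕ (Fin nC × Fin 2)))
        ((Fin nA × Fin 2) ⊕ ((Fin nB × Fin 2) ⊕ (Fin nC × Fin 2))) ℝ)
    (hVsymm : V.IsSymm) (hVpd : V.PosDef)
    (hQCM : QCM (fromBlocks (Omega nA) 0 0 (fromBlocks (Omega nB) 0 0 (Omega nC))) V) :
    (schurA (V.submatrix (embAC (b := Fin nB × Fin 2)) (embAC (b := Fin nB × Fin 2)))
      - (Omega nC)ᵀ * (schurA (V.submatrix Sum.inr Sum.inr))⁻¹ * Omega nC).PosSemidef := by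
  set S := schurA (V.submatrix (embAC (b := Fin nB × Fin 2)) (embAC (b := Fin nB × Fin 2))) with hS
  set T := schurA (V.submatrix (Sum.inr : _ → (Fin nA × Fin 2) ⊕ _) Sum.inr) with hT
  have hinj : Function.Injective (embAC (a := Fin nA × Fin 2) (b := Fin nB × Fin 2)
      (c := Fin nC × Fin 2)) := by
    rintro (i | i) (j | j) h <;> simp_all [embAC]
  have hSs : Sᵀ = S := schurA_symm _ (hVsymm.submatrix _)
  have hTs : Tᵀ = T := schurA_symm _ (hVsymm.submatrix _)
  have hTi : T⁻¹ᵀ = T⁻¹ := by rw [transpose_nonsing_inv, hTs]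
  have hTT : T⁻¹ * T * T⁻¹ = T⁻¹ := by
    by_cases h : IsUnit T.det
    · rw [nonsing_inv_mul _ h, Matrix.one_mul]
    · simp [nonsing_inv_apply_not_isUnit _ h]
  have key : ∀ x y, 0 ≤ x ⬝ᵥ S *ᵥ x + y ⬝ᵥ T *ᵥ y - 2 * (x ⬝ᵥ Omega nC *ᵥ y) := by
    intro x y
    obtain ⟨z, hz⟩ := schurA_quad _ (hVpd.submatrix hinj) x
    obtain ⟨w, hw⟩ := schurA_quad _ (hVpd.submatrix
      (Sum.inr_injective (α := Fin nA × Fin 2))) y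
    have hO : (fromBlocks (Omega nA) 0 0 (fromBlocks (Omega nB) 0 0 (Omega nC)))ᵀ
        = -(fromBlocks (Omega nA) 0 0 (fromBlocks (Omega nB) 0 0 (Omega nC))) := by
      simp [fromBlocks_transpose, fromBlocks_neg, Omega_transpose]
    have := qcm_real _ V hO hVsymm hQCM (Sum.elim z (Sum.elim 0 x)) (Sum.elim 0 (Sum.elim w y))
    rw [← hS] at hz
    rw [← hT] at hw
    rw [← hz, ← hw]
    convert this using 3
    · simp [dotProduct, mulVec, Fintype.sum_sum_type, embAC]
    · simp [dotProduct, mulVec, Fintype.sum_sum_type]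
    · simp [fromBlocks_mulVec, Function.comp_def, dotProduct, mulVec, Fintype.sum_sum_type]
  refine PosSemidef.of_dotProduct_mulVec_nonneg ?_ fun x => ?_
  · rw [IsHermitian, conjTranspose_eq_transpose_of_trivial]
    simp [hSs, hTi, Omega_transpose, Matrix.mul_assoc]
  · have h := key x (-((T⁻¹ * Omega nC) *ᵥ x))
    have e1 : (-((T⁻¹ * Omega nC) *ᵥ x)) ⬝ᵥ T *ᵥ (-((T⁻¹ * Omega nC) *ᵥ x))
        = x ⬝ᵥ ((Omega nC)ᵀ * T⁻¹ * Omega nC) *ᵥ x := by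
      rw [mulVec_neg, neg_dotProduct_neg, mulVec_mulVec, dotProduct_comm, dotProduct_mulVec,
        ← mulVec_transpose, mulVec_mulVec, dotProduct_comm, transpose_mul, hTi]
      congr 2
      conv_rhs => rw [← hTT]
      simp only [Matrix.mul_assoc]
    have e2 : x ⬝ᵥ Omega nC *ᵥ (-((T⁻¹ * Omega nC) *ᵥ x))
        = x ⬝ᵥ ((Omega nC)ᵀ * T⁻¹ * Omega nC) *ᵥ x := by
      rw [mulVec_neg, mulVec_mulVec, Omega_transpose, Matrix.neg_mul, Matrix.neg_mul, neg_mulVec,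
        Matrix.mul_assoc]
    rw [e1, e2] at h
    rw [star_trivial, sub_mulVec, dotProduct_sub]
    linarith

end
end

section
/- Let V be a real symmetric positive definite matrix partitioned into blocks corresponding to three subsystems A, B, C. Then log det V + log det V_C ≤ log det V_{AC} + log det V_{BC}, where V_C, V_{AC}, V_{BC} denote the indicated principal submatrices (strong subadditivity of the log-determinant). -/
open Matrix
open scoped ComplexOrder Kronecker

noncomputable section

theorem one_le_det_one_add {n : Type*} [Fintype n] [DecidableEq n] {N : Matrix n n ℝ}
    (hN : N.PosSemidef) : 1 ≤ (1 + N).det := by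
  set U := (hN.1.eigenvectorUnitary : Matrix n n ℝ) with hU
  have hUU : U * star U = 1 := Unitary.coe_mul_star_self hN.1.eigenvectorUnitary
  have hs : N = U * diagonal hN.1.eigenvalues * star U := by
    have := hN.1.spectral_theorem
    rw [Unitary.conjStarAlgAut_apply] at this
    exact this
  have h1 : 1 + N = U * diagonal (fun i => 1 + hN.1.eigenvalues i) * star U := by
    have : diagonal (fun i => 1 + hN.1.eigenvalues i) = 1 + diagonal hN.1.eigenvalues := by
      rw [← diagonal_one, diagonal_add]
    rw [this, mul_add, add_mul, mul_one, hUU, ← hs]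
  have h2 : (1 + N).det = ∏ i, (1 + hN.1.eigenvalues i) := by
    have h3 : U.det * (star U).det = 1 := by rw [← det_mul, hUU, det_one]
    rw [h1, det_mul, det_mul, det_diagonal, mul_right_comm, h3, one_mul]
  rw [h2]
  refine (Finset.prod_const_one (s := Finset.univ (α := n))).symm.le.trans ?_
  refine Finset.prod_le_prod (fun _ _ => zero_le_one) ?_
  intro i _
  have := hN.eigenvalues_nonneg i
  linarith

theorem det_le_det_add {n : Type*} [Fintype n] [DecidableEq n] {P Q : Matrix n n ℝ}
    (hP : P.PosDef) (hQ : Q.PosSemidef) : P.det ≤ (P + Q).det := by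
  obtain ⟨M, rfl⟩ : ∃ M : Matrix n n ℝ, Q = Mᴴ * M := by
    open scoped MatrixOrder in
    exact CStarAlgebra.nonneg_iff_eq_star_mul_self.mp (nonneg_iff_posSemidef.mpr hQ)
  rw [det_add_mul _ _ ((isUnit_iff_isUnit_det _).mp hP.isUnit)]
  have := one_le_det_one_add (hP.inv.posSemidef.mul_mul_conjTranspose_same M)
  exact le_mul_of_one_le_right hP.det_pos.le this

theorem logdet_aux {a b c : Type*} [Fintype a] [DecidableEq a] [Fintype b] [DecidableEq b]
    [Fintype c] [DecidableEq c] (V : Matrix (a ⊕ (b ⊕ c)) (a ⊕ (b ⊕ c)) ℝ) (hV : V.PosDef) :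
    Real.log V.det
        + Real.log (V.submatrix (Sum.inr ∘ Sum.inr) (Sum.inr ∘ Sum.inr)).det
      ≤ Real.log (V.submatrix (embAC (b := b)) (embAC (b := b))).det
        + Real.log (V.submatrix Sum.inr Sum.inr).det := by
  set A := V.toBlocks₁₁
  set B := V.toBlocks₁₂
  set D := V.toBlocks₂₂ with hD
  have hB : V.toBlocks₂₁ = Bᴴ := by
    ext i j
    exact (hV.1.apply (Sum.inr i) (Sum.inl j)).symm
  have hVb : V = fromBlocks A B Bᴴ D := by rw [← hB, fromBlocks_toBlocks]
  set B' : Matrix a c ℝ := B.submatrix id Sum.inr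
  set C : Matrix c c ℝ := D.submatrix Sum.inr Sum.inr with hC
  have e1 : V.submatrix (Sum.inr ∘ Sum.inr) (Sum.inr ∘ Sum.inr) = C := rfl
  have e2 : V.submatrix Sum.inr Sum.inr = D := rfl
  have key : ∀ X : Matrix a a ℝ, (fromBlocks X B Bᴴ D).submatrix (embAC (b := b)) (embAC (b := b))
      = fromBlocks X B' B'ᴴ C := by
    intro X
    ext i j
    rcases i with i | i <;> rcases j with j | j <;> rfl
  have hDp : D.PosDef := hV.submatrix Sum.inr_injective
  have hCp : C.PosDef := hDp.submatrix Sum.inr_injective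
  let : Invertible D := hDp.isUnit.invertible
  let : Invertible C := hCp.isUnit.invertible
  have d1 : V.det = D.det * (A - B * D⁻¹ * Bᴴ).det := by
    rw [hVb, det_fromBlocks₂₂, invOf_eq_nonsing_inv]
  have d2 : (V.submatrix (embAC (b := b)) (embAC (b := b))).det
      = C.det * (A - B' * C⁻¹ * B'ᴴ).det := by
    conv_lhs => rw [hVb]
    rw [key, det_fromBlocks₂₂, invOf_eq_nonsing_inv]
  have hS : (A - B * D⁻¹ * Bᴴ).PosSemidef :=
    (PosDef.fromBlocks₂₂ A B hDp).mp (hVb ▸ hV.posSemidef)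
  have hdV := hV.det_pos
  have hSp : (A - B * D⁻¹ * Bᴴ).PosDef := by
    rw [hS.posDef_iff_det_ne_zero]
    intro h
    rw [d1, h, mul_zero] at hdV
    exact lt_irrefl _ hdV
  have hQ : (B * D⁻¹ * Bᴴ - B' * C⁻¹ * B'ᴴ).PosSemidef := by
    have h0 : (fromBlocks (B * D⁻¹ * Bᴴ) B Bᴴ D).PosSemidef := by
      rw [PosDef.fromBlocks₂₂ _ _ hDp, sub_self]
      exact PosSemidef.zero
    have h1 := h0.submatrix (embAC (b := b))
    rwa [key, PosDef.fromBlocks₂₂ _ _ hCp] at h1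
  have hle := det_le_det_add hSp hQ
  rw [sub_add_sub_cancel] at hle
  have p1 := hSp.det_pos
  have hlog := Real.log_le_log p1 hle
  rw [e1, e2, d1, d2, Real.log_mul hDp.det_pos.ne' p1.ne',
    Real.log_mul hCp.det_pos.ne' (p1.trans_le hle).ne']
  linarith

/-- **Strong subadditivity of the log-determinant.** For a real symmetric positive
definite tripartite matrix `V` on `A ⊕ (B ⊕ C)`,
`log det V + log det V_C ≤ log det V_{AC} + log det V_{BC}`. -/
theorem logdet_strong_subadditivity (nA nB nC : ℕ)
    (V : Matrix ((Fin nA × Fin 2) ⊕ ((Fin nB × Fin 2) ⊕ (Fin nC × Fin 2)))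
        ((Fin nA × Fin 2) ⊕ ((Fin nB × Fin 2) ⊕ (Fin nC × Fin 2))) ℝ)
    (hVsymm : V.IsSymm) (hVpd : V.PosDef) :
    Real.log V.det
        + Real.log (V.submatrix (Sum.inr ∘ Sum.inr) (Sum.inr ∘ Sum.inr)).det
      ≤ Real.log (V.submatrix (embAC (b := Fin nB × Fin 2))
            (embAC (b := Fin nB × Fin 2))).det
        + Real.log (V.submatrix Sum.inr Sum.inr).det := by
  exact logdet_aux V hVpd

end
end

section
/- Let M = [[A, X],[X†, B]] be a complex Hermitian positive semidefinite block matrix, where A is a p×p positive definite block, B is a q×q block, and X is the p×q off-diagonal block. Then ‖X‖₂² ≤ ‖A‖₂ · ‖B‖₂, where ‖Y‖₂ = √(Tr Y†Y) denotes the Frobenius (Hilbert–Schmidt) norm. -/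
open Matrix
open scoped ComplexOrder Kronecker

noncomputable section

/-- The Frobenius (Hilbert–Schmidt) norm `‖Y‖₂ = √(Tr Y†Y)` of a complex matrix. -/
def frobNorm {p q : Type*} [Fintype p] [Fintype q] (Y : Matrix p q ℂ) : ℝ :=
  Real.sqrt (Yᴴ * Y).trace.re

theorem frob_aux_sq {p q : Type*} [Fintype p] [Fintype q] (Y : Matrix p q ℂ) :
    (Yᴴ * Y).trace.re = ∑ x : q × p, ‖Y x.2 x.1‖ ^ 2 := by
  rw [Fintype.sum_prod_type]
  simp only [Matrix.trace, Matrix.diag, Matrix.mul_apply, Complex.re_sum, conjTranspose_apply]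
  refine Finset.sum_congr rfl fun i _ => Finset.sum_congr rfl fun j _ => ?_
  rw [← Complex.normSq_eq_norm_sq, Complex.normSq_apply]
  simp

theorem frob_aux_cs {p q : Type*} [Fintype p] [Fintype q] (U V : Matrix p q ℂ) :
    (Uᴴ * V).trace.re ≤ frobNorm U * frobNorm V := by
  unfold frobNorm
  rw [frob_aux_sq, frob_aux_sq]
  refine le_trans ?_ (Real.sum_mul_le_sqrt_mul_sqrt _ _ _)
  rw [Fintype.sum_prod_type]
  simp only [Matrix.trace, Matrix.diag, Matrix.mul_apply, Complex.re_sum, conjTranspose_apply]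
  refine Finset.sum_le_sum fun i _ => Finset.sum_le_sum fun j _ => ?_
  refine (Complex.re_le_norm _).trans ?_
  simp

theorem frob_aux_swap {p q : Type*} [Fintype p] [Fintype q] (P : Matrix p q ℂ) :
    frobNorm (P * Pᴴ) = frobNorm (Pᴴ * P) := by
  unfold frobNorm
  congr 2
  simp only [conjTranspose_mul, conjTranspose_conjTranspose]
  rw [Matrix.mul_assoc, Matrix.trace_mul_comm]
  simp only [Matrix.mul_assoc]

/-- **Off-diagonal Frobenius norm bound.** If `M = [[A, X],[X†, B]]` is a complex
Hermitian positive semidefinite block matrix with `A` positive definite, then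
`‖X‖₂² ≤ ‖A‖₂ ‖B‖₂`. -/
theorem frobenius_offdiagonal_bound (p q : ℕ)
    (A : Matrix (Fin p) (Fin p) ℂ) (B : Matrix (Fin q) (Fin q) ℂ)
    (X : Matrix (Fin p) (Fin q) ℂ)
    (hM : (fromBlocks A X Xᴴ B).PosSemidef) (hA : A.PosDef) :
    frobNorm X ^ 2 ≤ frobNorm A * frobNorm B := by
  obtain ⟨S, hS⟩ : ∃ S : Matrix (Fin p ⊕ Fin q) (Fin p ⊕ Fin q) ℂ,
      fromBlocks A X Xᴴ B = Sᴴ * S := by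
    open scoped MatrixOrder in
    exact CStarAlgebra.nonneg_iff_eq_star_mul_self.mp (Matrix.nonneg_iff_posSemidef.mpr hM)
  set P : Matrix (Fin p ⊕ Fin q) (Fin p) ℂ := S.submatrix id Sum.inl with hP
  set Q : Matrix (Fin p ⊕ Fin q) (Fin q) ℂ := S.submatrix id Sum.inr with hQ
  have eA : A = Pᴴ * P := by
    ext i j
    have := congrFun (congrFun hS (Sum.inl i)) (Sum.inl j)
    rw [fromBlocks_apply₁₁, mul_apply] at this; rw [this, mul_apply]; rfl
  have eX : X = Pᴴ * Q := by
    ext i j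
    have := congrFun (congrFun hS (Sum.inl i)) (Sum.inr j)
    rw [fromBlocks_apply₁₂, mul_apply] at this; rw [this, mul_apply]; rfl
  have eB : B = Qᴴ * Q := by
    ext i j
    have := congrFun (congrFun hS (Sum.inr i)) (Sum.inr j)
    rw [fromBlocks_apply₂₂, mul_apply] at this; rw [this, mul_apply]; rfl
  have h := frob_aux_cs (P * Pᴴ) (Q * Qᴴ)
  rw [frob_aux_swap, frob_aux_swap, ← eA, ← eB] at h
  refine le_trans (le_of_eq ?_) h
  unfold frobNorm
  rw [Real.sq_sqrt (by rw [frob_aux_sq]; positivity), eX]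
  congr 1
  simp only [conjTranspose_mul, conjTranspose_conjTranspose]
  rw [Matrix.mul_assoc, Matrix.trace_mul_comm]
  simp only [Matrix.mul_assoc]

end
end
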